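/- Let G_n ~ PAPER(1, 0, θ) (uniform attachment tree plus Erdős–Rényi(θ) noise), let Π be uniformly random on Bi([n], U_n) independent of G_n, and G̃_n = Π G_n. Then for every connected labeled graph g̃_n on U_n and every node u ∈ U_n, the posterior root probability is proportional to the total number of histories over all spanning trees: P(Π_1 = u | G̃_n = g̃_n) ∝ Σ_{t̃_n ∈ 𝒯(g̃_n)} h(u, t̃_n), where the proportionality constant does not depend on u. -/

import Mathlib

open scoped Classical
open Finset

noncomputable section

/-- A parent map encoding a recursive tree on `Fin n` (nodes indexed by arrival
time, `0`-indexed): node `0` is the root, and every node `t ≠ 0` attaches to the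
earlier node `pa t`. -/
def IsParentMap {n : ℕ} (pa : Fin n → Fin n) : Prop :=
  (∀ t : Fin n, t.val = 0 → pa t = t) ∧ ∀ t : Fin n, t.val ≠ 0 → (pa t).val < t.val

/-- Degree of node `w` in the tree grown on the nodes `0, …, t`. -/
def degAt {n : ℕ} (pa : Fin n → Fin n) (t : ℕ) (w : Fin n) : ℕ :=
  (Finset.univ.filter (fun s : Fin n => 1 ≤ s.val ∧ s.val ≤ t ∧ pa s = w)).card +
    (if w.val ≠ 0 ∧ w.val ≤ t then 1 else 0)

/-- Probability that the affine preferential attachment process `APA(α,β)`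
produces the recursive tree encoded by `pa`: the product over arrival times of
the attachment probabilities `(β·deg + α) / (2·#edges·β + #nodes·α)`. -/
def apaProb {n : ℕ} (α β : ℝ) (pa : Fin n → Fin n) : ℝ :=
  ∏ t : Fin n,
    if 2 ≤ t.val then
      (β * degAt pa (t.val - 1) (pa t) + α) /
        (2 * ((t.val : ℝ) - 1) * β + (t.val : ℝ) * α)
    else 1

/-- The graph of the recursive tree encoded by `pa`. -/
def treeGraph {n : ℕ} (pa : Fin n → Fin n) : SimpleGraph (Fin n) :=
  SimpleGraph.fromRel (fun i j => j.val ≠ 0 ∧ pa j = i)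

/-- The mass function of `G_n ~ PAPER(α,β,θ)`: `G_n = T_n + R_n` is the union of
an `APA(α,β)` tree and an independent Erdős–Rényi(θ) graph (multi-edges collapsed). -/
def paperProb (n : ℕ) (α β θ : ℝ) (g : SimpleGraph (Fin n)) : ℝ :=
  θ ^ (g.edgeSet.ncard - (n - 1)) * (1 - θ) ^ (n * (n - 1) / 2 - g.edgeSet.ncard) *
    ∑ pa : Fin n → Fin n,
      if IsParentMap pa ∧ treeGraph pa ≤ g then apaProb α β pa else 0

variable {U : Type} [Fintype U] [DecidableEq U]

/-- Posterior root probability `P(Π₁ = u | Π G_n = g̃)` where `Π` is a uniformly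
random bijection (relabeling) `Fin n ≃ U` independent of `G_n ~ PAPER(α,β,θ)`. -/
def postRoot (n : ℕ) [NeZero n] (α β θ : ℝ) (g : SimpleGraph U) (u : U) : ℝ :=
  (∑ π : Fin n ≃ U, if π 0 = u then paperProb n α β θ (g.comap ⇑π) else 0) /
    ∑ π : Fin n ≃ U, paperProb n α β θ (g.comap ⇑π)


/-- `h(u, t̃)`: the number of histories of the labeled tree `t̃` that start at
node `u`, i.e. orderings `π ∈ Bi([n], U)` with `π₁ = u` such that every initial
segment `{π₁,…,π_t}` induces a connected subgraph of `t̃`. -/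
def histCount (n : ℕ) [NeZero n] (t : SimpleGraph U) (u : U) : ℕ :=
  {π : Fin n ≃ U | π 0 = u ∧
    ∀ s : Fin n, (t.induce (⇑π '' {i : Fin n | i ≤ s})).Connected}.ncard

/-- A graph on `Fin n` is a recursive tree when it is a tree and all prefixes are connected. -/
def IsRecTree {n : ℕ} (s : SimpleGraph (Fin n)) : Prop :=
  s.IsTree ∧ ∀ k : Fin n, (s.induce {i : Fin n | i ≤ k}).Connected

lemma treeGraph_adj_parent {n : ℕ} {pa : Fin n → Fin n} (h : IsParentMap pa) (t : Fin n)
    (ht : t.val ≠ 0) : (treeGraph pa).Adj (pa t) t := by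
  have h2 := h.2 t ht
  rw [treeGraph, SimpleGraph.fromRel_adj]
  exact ⟨fun e => by rw [e] at h2; exact lt_irrefl _ h2, Or.inl ⟨ht, rfl⟩⟩

lemma treeGraph_adj_lt {n : ℕ} {pa : Fin n → Fin n} (h : IsParentMap pa) {i t : Fin n}
    (hadj : (treeGraph pa).Adj i t) (hlt : i < t) : pa t = i := by
  rw [treeGraph, SimpleGraph.fromRel_adj] at hadj
  rcases hadj.2 with ⟨_, h1⟩ | ⟨h0, h1⟩
  · exact h1
  · have := h.2 i h0
    rw [h1] at this
    exact absurd hlt (not_lt.2 (le_of_lt (Fin.lt_def.2 this)))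

lemma treeGraph_prefix {n : ℕ} [NeZero n] {pa : Fin n → Fin n} (h : IsParentMap pa) (k : Fin n) :
    ((treeGraph pa).induce {i : Fin n | i ≤ k}).Connected := by
  rw [SimpleGraph.connected_iff_exists_forall_reachable]
  refine ⟨⟨0, Fin.zero_le k⟩, ?_⟩
  have key : ∀ m : ℕ, ∀ i : Fin n, ∀ hi : i ≤ k, i.val = m →
      ((treeGraph pa).induce {i : Fin n | i ≤ k}).Reachable ⟨0, Fin.zero_le k⟩ ⟨i, hi⟩ := by
    intro m
    induction m using Nat.strong_induction_on with
    | _ m ih =>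
      intro i hi him
      by_cases h0 : i.val = 0
      · have : i = 0 := Fin.ext (by simpa using h0)
        subst this
        exact SimpleGraph.Reachable.refl _
      · have h2 := h.2 i h0
        have hpk : pa i ≤ k := le_trans (le_of_lt (Fin.lt_def.2 h2)) hi
        refine (ih (pa i).val (by omega) (pa i) hpk rfl).trans ?_
        apply SimpleGraph.Adj.reachable
        exact treeGraph_adj_parent h i h0
  rintro ⟨i, hi⟩
  exact key _ i hi rfl

lemma treeGraph_connected {n : ℕ} [NeZero n] {pa : Fin n → Fin n} (h : IsParentMap pa) :
    (treeGraph pa).Connected := by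
  rw [SimpleGraph.connected_iff_exists_forall_reachable]
  refine ⟨0, fun i => ?_⟩
  have h1 := (treeGraph_prefix h i).preconnected ⟨0, Fin.zero_le i⟩ ⟨i, le_refl i⟩
  exact h1.map (SimpleGraph.Embedding.induce _).toHom

lemma treeGraph_isTree {n : ℕ} [NeZero n] {pa : Fin n → Fin n} (h : IsParentMap pa) :
    (treeGraph pa).IsTree := by
  rw [SimpleGraph.isTree_iff_connected_and_card]
  refine ⟨treeGraph_connected h, le_antisymm ?_
    (treeGraph_connected h).card_vert_le_card_edgeSet_add_one⟩
  have hsub : (treeGraph pa).edgeSet ⊆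
      (fun t : Fin n => s(pa t, t)) '' (((univ : Finset (Fin n)).erase 0 : Finset (Fin n)) :
        Set (Fin n)) := by
    intro e
    induction e using Sym2.ind with
    | _ x y =>
      intro he
      rw [SimpleGraph.mem_edgeSet, treeGraph, SimpleGraph.fromRel_adj] at he
      rcases he.2 with ⟨h0, h1⟩ | ⟨h0, h1⟩
      · refine ⟨y, ?_, by simp [h1]⟩
        simp only [coe_erase, coe_univ, Set.mem_sdiff, Set.mem_univ, true_and,
          Set.mem_singleton_iff]
        rintro rfl
        simp at h0
      · refine ⟨x, ?_, by simp [h1, Sym2.eq_swap]⟩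
        simp only [coe_erase, coe_univ, Set.mem_sdiff, Set.mem_univ, true_and,
          Set.mem_singleton_iff]
        rintro rfl
        simp at h0
  have h1 := Set.ncard_le_ncard hsub (Set.toFinite _)
  have h2 := Set.ncard_image_le (f := fun t : Fin n => s(pa t, t))
    (s := (((univ : Finset (Fin n)).erase 0 : Finset (Fin n)) : Set (Fin n))) (Set.toFinite _)
  rw [Set.ncard_coe_finset, Finset.card_erase_of_mem (Finset.mem_univ _), Finset.card_univ,
    Fintype.card_fin] at h2
  have h3 : Nat.card (treeGraph pa).edgeSet = (treeGraph pa).edgeSet.ncard := rfl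
  rw [h3, Nat.card_eq_fintype_card, Fintype.card_fin]
  have : n ≠ 0 := NeZero.ne n
  omega

lemma exists_parentMap {n : ℕ} [NeZero n] {s : SimpleGraph (Fin n)} (hs : IsRecTree s) :
    ∃ pa : Fin n → Fin n, IsParentMap pa ∧ treeGraph pa = s := by
  have key : ∀ t : Fin n, ∃ p : Fin n, (t.val = 0 → p = t) ∧
      (t.val ≠ 0 → p.val < t.val ∧ s.Adj p t) := by
    intro t
    by_cases h0 : t.val = 0
    · exact ⟨t, fun _ => rfl, fun h => absurd h0 h⟩
    · have hc := (hs.2 t).preconnected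
      have hnt : Nontrivial {i : Fin n | i ≤ t} := by
        refine ⟨⟨0, Fin.zero_le t⟩, ⟨t, le_refl t⟩, ?_⟩
        intro e
        apply h0
        have e' : (0 : Fin n) = t := Subtype.ext_iff.1 e
        rw [← e']
        simp
      obtain ⟨⟨p, hp⟩, hadj⟩ := hc.exists_adj_of_nontrivial ⟨t, le_refl t⟩
      have hadj' : s.Adj t p := hadj
      exact ⟨p, fun h => absurd h h0, fun _ =>
        ⟨Fin.lt_def.1 (lt_of_le_of_ne hp hadj'.ne'), hadj'.symm⟩⟩
  choose pa hpa using key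
  have hP : IsParentMap pa := ⟨fun t ht => (hpa t).1 ht, fun t ht => ((hpa t).2 ht).1⟩
  refine ⟨pa, hP, ?_⟩
  have hle : treeGraph pa ≤ s := by
    intro x y hxy
    rw [treeGraph, SimpleGraph.fromRel_adj] at hxy
    rcases hxy.2 with ⟨h0, h1⟩ | ⟨h0, h1⟩
    · exact h1 ▸ ((hpa y).2 h0).2
    · exact h1 ▸ ((hpa x).2 h0).2.symm
  exact le_antisymm hle
    ((SimpleGraph.isTree_iff_minimal_connected.1 hs.1).2 (treeGraph_connected hP) hle)

lemma treeGraph_inj {n : ℕ} {pa pb : Fin n → Fin n} (ha : IsParentMap pa)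
    (hb : IsParentMap pb) (h : treeGraph pa = treeGraph pb) : pa = pb := by
  funext t
  by_cases h0 : t.val = 0
  · rw [ha.1 t h0, hb.1 t h0]
  · have h1 := treeGraph_adj_parent ha t h0
    rw [h] at h1
    exact (treeGraph_adj_lt hb h1 (Fin.lt_def.2 (ha.2 t h0))).symm

lemma card_parentMap {n : ℕ} [NeZero n] (g : SimpleGraph (Fin n)) :
    (univ.filter fun pa : Fin n → Fin n => IsParentMap pa ∧ treeGraph pa ≤ g).card =
      (univ.filter fun s : SimpleGraph (Fin n) => s ≤ g ∧ IsRecTree s).card := by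
  refine Finset.card_bij (fun pa _ => treeGraph pa) ?_ ?_ ?_
  · intro pa hpa
    simp only [mem_filter, mem_univ, true_and] at hpa ⊢
    exact ⟨hpa.2, treeGraph_isTree hpa.1, treeGraph_prefix hpa.1⟩
  · intro pa hpa pb hpb h
    simp only [mem_filter, mem_univ, true_and] at hpa hpb
    exact treeGraph_inj hpa.1 hpb.1 h
  · intro s hs
    simp only [mem_filter, mem_univ, true_and] at hs
    obtain ⟨pa, h1, h2⟩ := exists_parentMap hs.2
    refine ⟨pa, ?_, h2⟩
    simp only [mem_filter, mem_univ, true_and]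
    exact ⟨h1, h2 ▸ hs.1⟩

/-- The restriction of a comap to a set is isomorphic to the restriction to the image. -/
def induceComapIso {V W : Type} (π : V ≃ W) (t : SimpleGraph W) (S : Set V) :
    (t.comap ⇑π).induce S ≃g t.induce (⇑π '' S) where
  toEquiv := π.image S
  map_rel_iff' := Iff.rfl

lemma isRecTree_comap {n : ℕ} {W : Type} (π : Fin n ≃ W) (t : SimpleGraph W) :
    IsRecTree (t.comap ⇑π) ↔
      t.IsTree ∧ ∀ s : Fin n, (t.induce (⇑π '' {i : Fin n | i ≤ s})).Connected := by
  unfold IsRecTree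
  rw [(SimpleGraph.Iso.comap π t).isTree_iff]
  refine and_congr_right fun _ => forall_congr' fun k => ?_
  exact (induceComapIso π t _).connected_iff

lemma comap_le_comap {V W : Type} (π : V ≃ W) (t g : SimpleGraph W) :
    t.comap ⇑π ≤ g.comap ⇑π ↔ t ≤ g := by
  constructor
  · intro h x y hxy
    have := @h (π.symm x) (π.symm y) (by simpa using hxy)
    simpa using this
  · intro h x y hxy
    exact h hxy

lemma card_parentMap_comap {n : ℕ} [NeZero n] {W : Type} [Fintype W] [DecidableEq W]
    (π : Fin n ≃ W) (g : SimpleGraph W) :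
    (univ.filter fun pa : Fin n → Fin n => IsParentMap pa ∧ treeGraph pa ≤ g.comap ⇑π).card =
      (univ.filter fun t : SimpleGraph W => (t ≤ g ∧ t.IsTree) ∧
        ∀ s : Fin n, (t.induce (⇑π '' {i : Fin n | i ≤ s})).Connected).card := by
  rw [card_parentMap]
  symm
  refine Finset.card_equiv π.symm.simpleGraph ?_
  intro t
  simp only [mem_filter, mem_univ, true_and]
  change _ ↔ t.comap ⇑π ≤ g.comap ⇑π ∧ IsRecTree (t.comap ⇑π)
  rw [comap_le_comap, isRecTree_comap, and_assoc]

lemma apaProb_one_zero {n : ℕ} (pa : Fin n → Fin n) :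
    apaProb 1 0 pa = ∏ t : Fin n, if 2 ≤ t.val then 1 / (t.val : ℝ) else 1 := by
  unfold apaProb
  simp

lemma paperProb_comap {n : ℕ} [NeZero n] {W : Type} [Fintype W] [DecidableEq W]
    (θ : ℝ) (g : SimpleGraph W) (π : Fin n ≃ W) :
    paperProb n 1 0 θ (g.comap ⇑π) =
      (θ ^ (g.edgeSet.ncard - (n - 1)) * (1 - θ) ^ (n * (n - 1) / 2 - g.edgeSet.ncard) *
        ∏ t : Fin n, if 2 ≤ t.val then 1 / (t.val : ℝ) else 1) *
      ∑ t : SimpleGraph W, if (t ≤ g ∧ t.IsTree) ∧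
        ∀ s : Fin n, (t.induce (⇑π '' {i : Fin n | i ≤ s})).Connected then (1 : ℝ) else 0 := by
  unfold paperProb
  have he : (g.comap ⇑π).edgeSet.ncard = g.edgeSet.ncard :=
    Nat.card_congr (SimpleGraph.Iso.comap π g).mapEdgeSet
  rw [he, mul_assoc, mul_assoc, mul_assoc]
  congr 2
  simp only [apaProb_one_zero]
  rw [Finset.sum_boole, ← card_parentMap_comap π g, ← Finset.sum_filter, Finset.sum_const,
    nsmul_eq_mul, mul_comm]

/-- **Posterior root probability under uniform attachment (Section
`combinatorial`).**  Let `G_n ~ PAPER(1,0,θ)` (uniform attachment tree plus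
Erdős–Rényi(θ) noise), `Π` uniform on `Bi([n],U)` independent of `G_n` and
`G̃_n = Π G_n`.  Then for every connected labeled graph `g̃` on `U`, the
posterior root probability is proportional — with a proportionality constant not
depending on `u` — to the total number of histories started at `u` over all
spanning trees of `g̃`:
`P(Π₁ = u | G̃_n = g̃) ∝ Σ_{t̃ ∈ 𝒯(g̃)} h(u, t̃)`. -/
theorem ua_posterior_proportional_to_history_count
    (n : ℕ) [NeZero n] (U : Type) [Fintype U] [DecidableEq U]
    (hcard : Fintype.card U = n)
    (θ : ℝ) (hθ0 : 0 < θ) (hθ1 : θ < 1)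
    (g : SimpleGraph U) (hg : g.Connected) :
    ∃ c : ℝ, ∀ u : U,
      postRoot n 1 0 θ g u =
        c * ∑ t : SimpleGraph U,
          if t ≤ g ∧ t.IsTree then (histCount n t u : ℝ) else 0 := by
  refine ⟨(θ ^ (g.edgeSet.ncard - (n - 1)) * (1 - θ) ^ (n * (n - 1) / 2 - g.edgeSet.ncard) *
        ∏ t : Fin n, if 2 ≤ t.val then 1 / (t.val : ℝ) else 1) /
      ∑ π : Fin n ≃ U, paperProb n 1 0 θ (g.comap ⇑π), fun u => ?_⟩
  unfold postRoot
  rw [div_mul_eq_mul_div]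
  congr 1
  have hh : ∀ t : SimpleGraph U, (histCount n t u : ℝ) =
      ∑ π : Fin n ≃ U, if π 0 = u ∧
        ∀ s : Fin n, (t.induce (⇑π '' {i : Fin n | i ≤ s})).Connected then (1 : ℝ) else 0 := by
    intro t
    unfold histCount
    rw [Finset.sum_boole, ← Set.ncard_coe_finset]
    simp
  simp only [hh, paperProb_comap]
  have hr : ∀ t : SimpleGraph U, (if t ≤ g ∧ t.IsTree then
      ∑ π : Fin n ≃ U, (if π 0 = u ∧
        ∀ s : Fin n, (t.induce (⇑π '' {i : Fin n | i ≤ s})).Connected then (1 : ℝ) else 0)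
        else 0) =
      ∑ π : Fin n ≃ U, if π 0 = u then (if (t ≤ g ∧ t.IsTree) ∧
        ∀ s : Fin n, (t.induce (⇑π '' {i : Fin n | i ≤ s})).Connected then (1 : ℝ) else 0)
        else 0 := by
    intro t
    by_cases h : t ≤ g ∧ t.IsTree
    · simp only [h, and_self, if_true, true_and, ite_and]
    · simp only [h, if_false, false_and, ite_self, Finset.sum_const_zero]
  simp only [hr]
  rw [Finset.sum_comm, Finset.mul_sum]
  refine Finset.sum_congr rfl fun π _ => ?_
  by_cases h : π 0 = u
  · simp only [h, if_true]
  · simp only [h, if_false, Finset.sum_const_zero, mul_zero]
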